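/- arXiv:2502.03550 — 7 statements merged into one kernel-verified Lean document; each statement's English description precedes it below -/
import Mathlib

section
/- Let π and π' be two stationary stochastic policies for a finite MDP whose reward function satisfies 0 ≤ r(s,a) ≤ R_max for all (s,a), with R_max > 0, and let ρ0 be any initial distribution on S. Then max_{s∈S} D_TV(π'(·|s) ‖ π(·|s)) ≥ ((1 − γ)² / (2·R_max)) · |J^π − J^{π'}|. -/
/-- Total variation distance between two probability mass functions on a finite set. -/
noncomputable def tv {X : Type*} [Fintype X] (p q : X → ℝ) : ℝ :=
  (1 / 2) * ∑ x, |p x - q x|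

/-- `p` is a probability mass function on a finite set. -/
def IsPMF {X : Type*} [Fintype X] (p : X → ℝ) : Prop :=
  (∀ x, 0 ≤ p x) ∧ ∑ x, p x = 1

/-- Time-`t` state distribution `d^π_t` of policy `π` started from `ρ0`. -/
noncomputable def stateDist {S A : Type*} [Fintype S] [Fintype A]
    (ρ : S → A → S → ℝ) (π : S → A → ℝ) (ρ0 : S → ℝ) : ℕ → S → ℝ
  | 0 => ρ0
  | t + 1 => fun s' => ∑ s, ∑ a, (stateDist ρ π ρ0 t s * π s a) * ρ s a s'

/-- Time-`t` state–action distribution `p^π_t` of policy `π` started from `ρ0`. -/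
noncomputable def saDist {S A : Type*} [Fintype S] [Fintype A]
    (ρ : S → A → S → ℝ) (π : S → A → ℝ) (ρ0 : S → ℝ) (t : ℕ) : S × A → ℝ :=
  fun sa => stateDist ρ π ρ0 t sa.1 * π sa.1 sa.2

/-- Discounted return `J^π = Σ_t γ^t Σ_{(s,a)} p^π_t(s,a) r(s,a)`. -/
noncomputable def discReturn {S A : Type*} [Fintype S] [Fintype A]
    (ρ : S → A → S → ℝ) (π : S → A → ℝ) (ρ0 : S → ℝ) (r : S → A → ℝ) (γ : ℝ) : ℝ :=
  ∑' t : ℕ, γ ^ t * ∑ s, ∑ a, saDist ρ π ρ0 t (s, a) * r s a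

theorem stateDist_isPMF {S A : Type*} [Fintype S] [Fintype A]
    (ρ : S → A → S → ℝ) (hρ : ∀ s a, IsPMF (ρ s a))
    (π : S → A → ℝ) (hπ : ∀ s, IsPMF (π s)) (ρ0 : S → ℝ) (hρ0 : IsPMF ρ0) (t : ℕ) :
    IsPMF (stateDist ρ π ρ0 t) := by
  induction t with
  | zero => exact hρ0
  | succ t ih =>
    refine ⟨fun s' => ?_, ?_⟩
    · exact Finset.sum_nonneg fun s _ => Finset.sum_nonneg fun a _ =>
        mul_nonneg (mul_nonneg (ih.1 s) ((hπ s).1 a)) ((hρ s a).1 s')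
    · show ∑ s', ∑ s, ∑ a, (stateDist ρ π ρ0 t s * π s a) * ρ s a s' = 1
      rw [Finset.sum_comm, ← ih.2]
      refine Finset.sum_congr rfl fun s _ => ?_
      rw [Finset.sum_comm]
      simp_rw [← Finset.mul_sum, (hρ s _).2, mul_one]
      rw [← Finset.mul_sum, (hπ s).2, mul_one]

theorem sa_step {S A : Type*} [Fintype S] [Fintype A]
    (π π' : S → A → ℝ) (hπ : ∀ s, IsPMF (π s)) (d d' : S → ℝ) (hd' : IsPMF d') (ε : ℝ)
    (hε : ∀ s, tv (π' s) (π s) ≤ ε) :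
    ∑ s, ∑ a, |d s * π s a - d' s * π' s a| ≤ ∑ s, |d s - d' s| + 2 * ε := by
  have key : ∀ s, ∑ a, |d s * π s a - d' s * π' s a| ≤ |d s - d' s| + d' s * (2 * ε) := by
    intro s
    have h1 : ∑ a, |π' s a - π s a| ≤ 2 * ε := by
      have := hε s
      unfold tv at this
      linarith
    calc ∑ a, |d s * π s a - d' s * π' s a|
        ≤ ∑ a, (|d s - d' s| * π s a + d' s * |π' s a - π s a|) := by
          refine Finset.sum_le_sum fun a _ => ?_
          have e : d s * π s a - d' s * π' s a
            = (d s - d' s) * π s a - d' s * (π' s a - π s a) := by ring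
          rw [e]
          refine (abs_sub _ _).trans ?_
          rw [abs_mul, abs_mul, abs_of_nonneg ((hπ s).1 a), abs_of_nonneg (hd'.1 s)]
      _ = |d s - d' s| + d' s * ∑ a, |π' s a - π s a| := by
          rw [Finset.sum_add_distrib, ← Finset.mul_sum, ← Finset.mul_sum, (hπ s).2, mul_one]
      _ ≤ _ := by
          have := mul_le_mul_of_nonneg_left h1 (hd'.1 s)
          linarith
  calc _ ≤ ∑ s, (|d s - d' s| + d' s * (2 * ε)) := Finset.sum_le_sum fun s _ => key s
    _ = _ := by rw [Finset.sum_add_distrib, ← Finset.sum_mul, hd'.2, one_mul]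

theorem stateDist_diff {S A : Type*} [Fintype S] [Fintype A]
    (ρ : S → A → S → ℝ) (hρ : ∀ s a, IsPMF (ρ s a))
    (π π' : S → A → ℝ) (hπ : ∀ s, IsPMF (π s)) (hπ' : ∀ s, IsPMF (π' s))
    (ρ0 : S → ℝ) (hρ0 : IsPMF ρ0) (ε : ℝ)
    (hε : ∀ s, tv (π' s) (π s) ≤ ε) (t : ℕ) :
    ∑ s, |stateDist ρ π ρ0 t s - stateDist ρ π' ρ0 t s| ≤ t * (2 * ε) := by
  induction t with
  | zero => simp [stateDist]
  | succ t ih =>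
    have h := sa_step π π' hπ (stateDist ρ π ρ0 t) (stateDist ρ π' ρ0 t)
      (stateDist_isPMF ρ hρ π' hπ' ρ0 hρ0 t) ε hε
    have h2 : ∑ s', |stateDist ρ π ρ0 (t+1) s' - stateDist ρ π' ρ0 (t+1) s'| ≤
        ∑ s, ∑ a, |stateDist ρ π ρ0 t s * π s a - stateDist ρ π' ρ0 t s * π' s a| := by
      calc _ ≤ ∑ s', ∑ s, ∑ a,
            |stateDist ρ π ρ0 t s * π s a - stateDist ρ π' ρ0 t s * π' s a| * ρ s a s' := by
            refine Finset.sum_le_sum fun s' _ => ?_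
            simp only [stateDist]
            rw [← Finset.sum_sub_distrib]
            refine (Finset.abs_sum_le_sum_abs _ _).trans (Finset.sum_le_sum fun s _ => ?_)
            rw [← Finset.sum_sub_distrib]
            refine (Finset.abs_sum_le_sum_abs _ _).trans (Finset.sum_le_sum fun a _ => ?_)
            rw [← sub_mul, abs_mul, abs_of_nonneg ((hρ s a).1 s')]
        _ = _ := by
            rw [Finset.sum_comm]
            refine Finset.sum_congr rfl fun s _ => ?_
            rw [Finset.sum_comm]
            simp_rw [← Finset.mul_sum, (hρ s _).2, mul_one]
    push_cast
    linarith

theorem reward_bound {S A : Type*} [Fintype S] [Fintype A]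
    (ρ : S → A → S → ℝ) (hρ : ∀ s a, IsPMF (ρ s a))
    (r : S → A → ℝ) (Rmax : ℝ)
    (hr : ∀ s a, 0 ≤ r s a ∧ r s a ≤ Rmax)
    (π : S → A → ℝ) (hπ : ∀ s, IsPMF (π s)) (ρ0 : S → ℝ) (hρ0 : IsPMF ρ0) (t : ℕ) :
    0 ≤ ∑ s, ∑ a, saDist ρ π ρ0 t (s, a) * r s a ∧
    ∑ s, ∑ a, saDist ρ π ρ0 t (s, a) * r s a ≤ Rmax := by
  have hd := stateDist_isPMF ρ hρ π hπ ρ0 hρ0 t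
  have hn : ∀ s a, 0 ≤ saDist ρ π ρ0 t (s, a) := fun s a => mul_nonneg (hd.1 s) ((hπ s).1 a)
  constructor
  · exact Finset.sum_nonneg fun s _ => Finset.sum_nonneg fun a _ => mul_nonneg (hn s a) (hr s a).1
  · calc _ ≤ ∑ s, ∑ a, saDist ρ π ρ0 t (s, a) * Rmax :=
          Finset.sum_le_sum fun s _ => Finset.sum_le_sum fun a _ =>
            mul_le_mul_of_nonneg_left (hr s a).2 (hn s a)
      _ = Rmax := by
          simp only [saDist, ← Finset.sum_mul, ← Finset.mul_sum, (hπ _).2, mul_one, hd.2, one_mul]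

theorem disc_summable {S A : Type*} [Fintype S] [Fintype A]
    (ρ : S → A → S → ℝ) (hρ : ∀ s a, IsPMF (ρ s a))
    (r : S → A → ℝ) (Rmax : ℝ)
    (hr : ∀ s a, 0 ≤ r s a ∧ r s a ≤ Rmax)
    (γ : ℝ) (hγ0 : 0 < γ) (hγ1 : γ < 1)
    (π : S → A → ℝ) (hπ : ∀ s, IsPMF (π s)) (ρ0 : S → ℝ) (hρ0 : IsPMF ρ0) :
    Summable fun t : ℕ => γ ^ t * ∑ s, ∑ a, saDist ρ π ρ0 t (s, a) * r s a := by
  have hb := reward_bound ρ hρ r Rmax hr π hπ ρ0 hρ0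
  refine Summable.of_nonneg_of_le (fun t => mul_nonneg (by positivity) (hb t).1)
    (fun t => mul_le_mul_of_nonneg_left (hb t).2 (by positivity))
    ((summable_geometric_of_lt_one hγ0.le hγ1).mul_right Rmax)

/-- **Policy divergence lower bound.** For policies `π, π'` of a finite MDP with rewards
in `[0, Rmax]`, `Rmax > 0`, and any initial distribution `ρ0`:
`max_s D_TV(π'(·|s) ‖ π(·|s)) ≥ ((1 − γ)² / (2 Rmax)) |J^π − J^{π'}|`. -/
theorem policy_divergence_lower_bound
    {S A : Type*} [Fintype S] [Nonempty S] [Fintype A] [Nonempty A]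
    (ρ : S → A → S → ℝ) (hρ : ∀ s a, IsPMF (ρ s a))
    (r : S → A → ℝ) (Rmax : ℝ) (hRmax : 0 < Rmax)
    (hr : ∀ s a, 0 ≤ r s a ∧ r s a ≤ Rmax)
    (γ : ℝ) (hγ0 : 0 < γ) (hγ1 : γ < 1)
    (π π' : S → A → ℝ) (hπ : ∀ s, IsPMF (π s)) (hπ' : ∀ s, IsPMF (π' s))
    (ρ0 : S → ℝ) (hρ0 : IsPMF ρ0) :
    ((1 - γ) ^ 2 / (2 * Rmax)) *
        |discReturn ρ π ρ0 r γ - discReturn ρ π' ρ0 r γ| ≤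
      Finset.univ.sup' Finset.univ_nonempty (fun s => tv (π' s) (π s)) := by
  set ε := Finset.univ.sup' Finset.univ_nonempty (fun s => tv (π' s) (π s)) with hεd
  have hε : ∀ s, tv (π' s) (π s) ≤ ε := fun s =>
    Finset.le_sup' (fun s => tv (π' s) (π s)) (Finset.mem_univ s)
  have hg : HasSum (fun t : ℕ => ((t : ℝ) + 1) * γ ^ t) (1 / (1 - γ) ^ 2) := by
    have hn : ‖γ‖ < 1 := by rw [Real.norm_eq_abs, abs_of_pos hγ0]; exact hγ1
    have h := (hasSum_coe_mul_geometric_of_norm_lt_one hn).add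
      (hasSum_geometric_of_lt_one hγ0.le hγ1)
    have h1 : (1 - γ) ≠ 0 := by linarith
    have e : γ / (1 - γ) ^ 2 + (1 - γ)⁻¹ = 1 / (1 - γ) ^ 2 := by field_simp; ring
    rw [e] at h
    refine h.congr_fun ?_
    intro t; ring
  have hdiff : |discReturn ρ π ρ0 r γ - discReturn ρ π' ρ0 r γ| ≤
      (1 / (1 - γ) ^ 2) * (2 * ε * Rmax) := by
    unfold discReturn
    rw [← (disc_summable ρ hρ r Rmax hr γ hγ0 hγ1 π hπ ρ0 hρ0).tsum_sub
      (disc_summable ρ hρ r Rmax hr γ hγ0 hγ1 π' hπ' ρ0 hρ0), ← Real.norm_eq_abs]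
    refine tsum_of_norm_bounded (hg.mul_right _) fun t => ?_
    have h1 := sa_step π π' hπ (stateDist ρ π ρ0 t) (stateDist ρ π' ρ0 t)
      (stateDist_isPMF ρ hρ π' hπ' ρ0 hρ0 t) ε hε
    have h2 := stateDist_diff ρ hρ π π' hπ hπ' ρ0 hρ0 ε hε t
    rw [← mul_sub, Real.norm_eq_abs, abs_mul, abs_of_pos (pow_pos hγ0 t)]
    have h3 : |∑ s, ∑ a, saDist ρ π ρ0 t (s, a) * r s a
        - ∑ s, ∑ a, saDist ρ π' ρ0 t (s, a) * r s a| ≤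
        (∑ s, ∑ a, |stateDist ρ π ρ0 t s * π s a - stateDist ρ π' ρ0 t s * π' s a|) * Rmax := by
      rw [← Finset.sum_sub_distrib, Finset.sum_mul]
      refine (Finset.abs_sum_le_sum_abs _ _).trans (Finset.sum_le_sum fun s _ => ?_)
      rw [← Finset.sum_sub_distrib, Finset.sum_mul]
      refine (Finset.abs_sum_le_sum_abs _ _).trans (Finset.sum_le_sum fun a _ => ?_)
      rw [← sub_mul, abs_mul, abs_of_nonneg (hr s a).1]
      exact mul_le_mul_of_nonneg_left (hr s a).2 (abs_nonneg _)
    have h4 := h3.trans (mul_le_mul_of_nonneg_right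
      (show _ ≤ ((t : ℝ) + 1) * (2 * ε) by linarith) hRmax.le)
    calc _ ≤ γ ^ t * (((t : ℝ) + 1) * (2 * ε) * Rmax) :=
          mul_le_mul_of_nonneg_left h4 (pow_pos hγ0 t).le
      _ = _ := by ring
  have hp : 0 < 1 - γ := by linarith
  calc _ ≤ ((1 - γ) ^ 2 / (2 * Rmax)) * ((1 / (1 - γ) ^ 2) * (2 * ε * Rmax)) :=
        mul_le_mul_of_nonneg_left hdiff (by positivity)
    _ = ε := by field_simp
end

section
/- Let π and π' be two stationary stochastic policies for a finite MDP and let ρ0 be any initial distribution on S. Then for every t ≥ 0, the time-t state–action distributions satisfy D_TV(p^π_t ‖ p^{π'}_t) ≤ (t + 1) · max_{s∈S} D_TV(π(·|s) ‖ π'(·|s)). -/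
theorem stateDist_diff_le {S A : Type*} [Fintype S] [Fintype A]
    (ρ : S → A → S → ℝ) (hρ : ∀ s a, IsPMF (ρ s a))
    (π π' : S → A → ℝ) (ρ0 : S → ℝ) (t : ℕ) :
    ∑ s', |stateDist ρ π ρ0 (t + 1) s' - stateDist ρ π' ρ0 (t + 1) s'| ≤
      ∑ s, ∑ a, |stateDist ρ π ρ0 t s * π s a - stateDist ρ π' ρ0 t s * π' s a| := by
  calc _ ≤ ∑ s', ∑ s, ∑ a,
        |stateDist ρ π ρ0 t s * π s a - stateDist ρ π' ρ0 t s * π' s a| * ρ s a s' := by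
        refine Finset.sum_le_sum fun s' _ => ?_
        simp only [stateDist, ← Finset.sum_sub_distrib, ← sub_mul]
        refine (Finset.abs_sum_le_sum_abs _ _).trans (Finset.sum_le_sum fun s _ => ?_)
        refine (Finset.abs_sum_le_sum_abs _ _).trans (Finset.sum_le_sum fun a _ => ?_)
        rw [abs_mul, abs_of_nonneg ((hρ s a).1 s')]
    _ = _ := by
        rw [Finset.sum_comm]
        refine Finset.sum_congr rfl fun s _ => ?_
        rw [Finset.sum_comm]
        simp only [← Finset.mul_sum, (hρ _ _).2, mul_one]

theorem sa_diff_le {S A : Type*} [Fintype S] [Fintype A]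
    (π π' : S → A → ℝ) (hπ : ∀ s, IsPMF (π s)) (d d' : S → ℝ) (hd' : IsPMF d')
    (M : ℝ) (hM : ∀ s, tv (π s) (π' s) ≤ M) :
    ∑ s, ∑ a, |d s * π s a - d' s * π' s a| ≤ ∑ s, |d s - d' s| + 2 * M := by
  calc _ ≤ ∑ s, (|d s - d' s| + d' s * (2 * M)) := by
        refine Finset.sum_le_sum fun s _ => ?_
        calc _ ≤ ∑ a, (|d s - d' s| * π s a + d' s * |π s a - π' s a|) := by
              refine Finset.sum_le_sum fun a _ => ?_
              have h : d s * π s a - d' s * π' s a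
                  = (d s - d' s) * π s a + d' s * (π s a - π' s a) := by ring
              rw [h]
              refine (abs_add_le _ _).trans ?_
              rw [abs_mul, abs_mul, abs_of_nonneg ((hπ s).1 a), abs_of_nonneg (hd'.1 s)]
          _ = |d s - d' s| + d' s * ∑ a, |π s a - π' s a| := by
              rw [Finset.sum_add_distrib, ← Finset.mul_sum, ← Finset.mul_sum, (hπ s).2, mul_one]
          _ ≤ _ := by
              have h := hM s
              unfold tv at h
              have := mul_le_mul_of_nonneg_left
                (show ∑ a, |π s a - π' s a| ≤ 2 * M by linarith) (hd'.1 s)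
              linarith
    _ = _ := by
        rw [Finset.sum_add_distrib, ← Finset.sum_mul, hd'.2, one_mul]

/-- **State–action distribution TV bound.** For policies `π, π'` of a finite MDP and any
initial distribution `ρ0`, for every `t ≥ 0`:
`D_TV(p^π_t ‖ p^{π'}_t) ≤ (t + 1) · max_s D_TV(π(·|s) ‖ π'(·|s))`. -/
theorem saDist_tv_le
    {S A : Type*} [Fintype S] [Nonempty S] [Fintype A] [Nonempty A]
    (ρ : S → A → S → ℝ) (hρ : ∀ s a, IsPMF (ρ s a))
    (r : S → A → ℝ) (γ : ℝ) (hγ0 : 0 < γ) (hγ1 : γ < 1)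
    (π π' : S → A → ℝ) (hπ : ∀ s, IsPMF (π s)) (hπ' : ∀ s, IsPMF (π' s))
    (ρ0 : S → ℝ) (hρ0 : IsPMF ρ0) (t : ℕ) :
    tv (saDist ρ π ρ0 t) (saDist ρ π' ρ0 t) ≤
      ((t : ℝ) + 1) * Finset.univ.sup' Finset.univ_nonempty (fun s => tv (π s) (π' s)) := by
  set M := Finset.univ.sup' Finset.univ_nonempty (fun s => tv (π s) (π' s)) with hMdef
  have hM : ∀ s, tv (π s) (π' s) ≤ M := fun s =>
    Finset.le_sup' (fun s => tv (π s) (π' s)) (Finset.mem_univ s)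
  have hstep : ∀ t, ∑ s, ∑ a,
      |stateDist ρ π ρ0 t s * π s a - stateDist ρ π' ρ0 t s * π' s a| ≤
      ∑ s, |stateDist ρ π ρ0 t s - stateDist ρ π' ρ0 t s| + 2 * M := fun t =>
    sa_diff_le π π' hπ _ _ (stateDist_isPMF ρ hρ π' hπ' ρ0 hρ0 t) M hM
  have key : ∀ t : ℕ, ∑ s, |stateDist ρ π ρ0 t s - stateDist ρ π' ρ0 t s| ≤ t * (2 * M) := by
    intro t
    induction t with
    | zero => simp [stateDist]
    | succ t ih =>
      have h1 := stateDist_diff_le ρ hρ π π' ρ0 t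
      have h2 := hstep t
      push_cast
      linarith
  have h1 := hstep t
  have h2 := key t
  simp only [tv, saDist, Fintype.sum_prod_type]
  linarith
end

section
/- Let S and A be finite nonempty sets, let p and q be probability mass functions on S, and let π and π' assign to each s ∈ S a probability mass function on A. Define the joint distributions (p⊗π)(s,a) = p(s)·π(a|s) and (q⊗π')(s,a) = q(s)·π'(a|s) on S×A. Then D_TV(p⊗π ‖ q⊗π') ≤ D_TV(p ‖ q) + max_{s∈S} D_TV(π(·|s) ‖ π'(·|s)). -/
/-- **Joint-distribution TV bound.** For PMFs `p, q` on `S` and conditional PMFs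
`π(·|s), π'(·|s)` on `A`:
`D_TV(p ⊗ π ‖ q ⊗ π') ≤ D_TV(p ‖ q) + max_s D_TV(π(·|s) ‖ π'(·|s))`. -/
theorem joint_tv_le
    {S A : Type*} [Fintype S] [Nonempty S] [Fintype A] [Nonempty A]
    (p q : S → ℝ) (hp : IsPMF p) (hq : IsPMF q)
    (π π' : S → A → ℝ) (hπ : ∀ s, IsPMF (π s)) (hπ' : ∀ s, IsPMF (π' s)) :
    tv (fun sa : S × A => p sa.1 * π sa.1 sa.2)
        (fun sa : S × A => q sa.1 * π' sa.1 sa.2) ≤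
      tv p q + Finset.univ.sup' Finset.univ_nonempty (fun s => tv (π s) (π' s)) := by
  set M := Finset.univ.sup' Finset.univ_nonempty (fun s => tv (π s) (π' s)) with hM
  have hle : ∀ s, tv (π s) (π' s) ≤ M := fun s =>
    Finset.le_sup' (fun s => tv (π s) (π' s)) (Finset.mem_univ s)
  have key : ∀ s, ∑ a, |p s * π s a - q s * π' s a| ≤ |p s - q s| + q s * (2 * M) := by
    intro s
    have h1 : ∑ a, |p s * π s a - q s * π' s a|
        ≤ ∑ a, (|p s - q s| * π s a + q s * |π s a - π' s a|) := by
      apply Finset.sum_le_sum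
      intro a _
      have e : p s * π s a - q s * π' s a
          = (p s - q s) * π s a + q s * (π s a - π' s a) := by ring
      rw [e]
      refine (abs_add_le _ _).trans ?_
      rw [abs_mul, abs_mul, abs_of_nonneg ((hπ s).1 a), abs_of_nonneg (hq.1 s)]
    rw [Finset.sum_add_distrib, ← Finset.mul_sum, ← Finset.mul_sum, (hπ s).2, mul_one] at h1
    have h2 : ∑ a, |π s a - π' s a| ≤ 2 * M := by
      have := hle s
      unfold tv at this
      linarith
    have h3 := mul_le_mul_of_nonneg_left h2 (hq.1 s)
    linarith
  have tot := Finset.sum_le_sum (fun s (_ : s ∈ Finset.univ) => key s)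
  rw [Finset.sum_add_distrib, ← Finset.sum_mul, hq.2] at tot
  clear_value M
  unfold tv
  rw [Fintype.sum_prod_type]
  dsimp only
  linarith
end

section
/- Consider a finite MDP, a function V̂ : S → ℝ, and a policy π' that is greedy with respect to V̂. If ‖V* − V̂‖_∞ ≤ ξ for some ξ ≥ 0, then for every state s, V*(s) − V^{π'}(s) ≤ 2·γ·ξ / (1 − γ). -/
/-- `V` is the value function of policy `π`: it solves the Bellman equation
`V(s) = Σ_a π(a|s)(r(s,a) + γ Σ_{s'} ρ(s'|s,a) V(s'))`. -/
def IsValue {S A : Type*} [Fintype S] [Fintype A]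
    (ρ : S → A → S → ℝ) (r : S → A → ℝ) (γ : ℝ) (π : S → A → ℝ) (V : S → ℝ) : Prop :=
  ∀ s, V s = ∑ a, π s a * (r s a + γ * ∑ s', ρ s a s' * V s')

/-- `V` is the optimal value function: it solves
`V(s) = max_a (r(s,a) + γ Σ_{s'} ρ(s'|s,a) V(s'))`. -/
def IsOptValue {S A : Type*} [Fintype S] [Fintype A] [Nonempty A]
    (ρ : S → A → S → ℝ) (r : S → A → ℝ) (γ : ℝ) (V : S → ℝ) : Prop :=
  ∀ s, V s = Finset.univ.sup' Finset.univ_nonempty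
      (fun a => r s a + γ * ∑ s', ρ s a s' * V s')

/-- `π'` is greedy with respect to `Vhat`: in each state its support consists of actions
maximizing `a ↦ r(s,a) + γ Σ_{s'} ρ(s'|s,a) Vhat(s')`. -/
def IsGreedy {S A : Type*} [Fintype S] [Fintype A]
    (ρ : S → A → S → ℝ) (r : S → A → ℝ) (γ : ℝ) (Vhat : S → ℝ) (π' : S → A → ℝ) : Prop :=
  ∀ s a, π' s a ≠ 0 → ∀ a',
    r s a' + γ * ∑ s', ρ s a' s' * Vhat s' ≤ r s a + γ * ∑ s', ρ s a s' * Vhat s'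

/-- Sup norm `max_s |f s|` over a finite nonempty state space. -/
noncomputable def supNorm {S : Type*} [Fintype S] [Nonempty S] (f : S → ℝ) : ℝ :=
  Finset.univ.sup' Finset.univ_nonempty fun s => |f s|

theorem isPMF_sum_le {X : Type*} [Fintype X] {p : X → ℝ} (hp : IsPMF p) (f g : X → ℝ) (c : ℝ)
    (h : ∀ x, p x ≠ 0 → f x ≤ g x + c) : ∑ x, p x * f x ≤ (∑ x, p x * g x) + c := by
  have h1 : ∑ x, p x * f x ≤ ∑ x, (p x * g x + p x * c) := by
    refine Finset.sum_le_sum fun x _ => ?_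
    by_cases hx : p x = 0
    · simp [hx]
    · have := mul_le_mul_of_nonneg_left (h x hx) (hp.1 x)
      linarith
  rw [Finset.sum_add_distrib, ← Finset.sum_mul, hp.2, one_mul] at h1
  exact h1

/-- **Greedy policy performance bound (Singh–Yee).** If `π'` is greedy with respect to `Vhat`
and `‖V* − Vhat‖_∞ ≤ ξ`, then for every state `s`, `V*(s) − V^{π'}(s) ≤ 2γξ/(1 − γ)`. -/
theorem greedy_policy_value_loss
    {S A : Type*} [Fintype S] [Nonempty S] [Fintype A] [Nonempty A]
    (ρ : S → A → S → ℝ) (hρ : ∀ s a, IsPMF (ρ s a))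
    (r : S → A → ℝ) (γ : ℝ) (hγ0 : 0 < γ) (hγ1 : γ < 1)
    (Vstar : S → ℝ) (hVstar : IsOptValue ρ r γ Vstar)
    (Vhat : S → ℝ)
    (π' : S → A → ℝ) (hπ'pmf : ∀ s, IsPMF (π' s)) (hgreedy : IsGreedy ρ r γ Vhat π')
    (Vπ' : S → ℝ) (hVπ' : IsValue ρ r γ π' Vπ')
    (ξ : ℝ) (hξ : 0 ≤ ξ) (hbound : ∀ s, |Vstar s - Vhat s| ≤ ξ) :
    ∀ s, Vstar s - Vπ' s ≤ 2 * γ * ξ / (1 - γ) := by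
  obtain ⟨s0, hs0⟩ := Finite.exists_max (fun s => Vstar s - Vπ' s)
  intro s
  refine (hs0 s).trans ?_
  set M := Vstar s0 - Vπ' s0 with hM
  obtain ⟨b, -, hb⟩ := Finset.exists_mem_eq_sup' (Finset.univ_nonempty (α := A))
    (fun a => r s0 a + γ * ∑ s', ρ s0 a s' * Vstar s')
  have hV := (hVstar s0).trans hb
  have h1 := isPMF_sum_le (hρ s0 b) Vstar Vhat ξ fun x _ => by
    have := abs_le.1 (hbound x)
    linarith [this.2]
  have h1' := mul_le_mul_of_nonneg_left h1 hγ0.le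
  have key := isPMF_sum_le (hπ'pmf s0) (fun _ => Vstar s0)
    (fun a => r s0 a + γ * ∑ s', ρ s0 a s' * Vπ' s') (2 * γ * ξ + γ * M) fun a ha => by
    have h2 := isPMF_sum_le (hρ s0 a) Vhat Vπ' (M + ξ) fun x _ => by
      have := abs_le.1 (hbound x)
      have h3 : Vstar x - Vπ' x ≤ M := hs0 x
      linarith [this.1]
    have h2' := mul_le_mul_of_nonneg_left h2 hγ0.le
    have h4 := hgreedy s0 a ha b
    linarith
  rw [← Finset.sum_mul, (hπ'pmf s0).2, one_mul, ← hVπ' s0] at key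
  rw [le_div_iff₀ (by linarith)]
  linarith
end

section
/- Consider a finite MDP and a sequence of policies (π_k)_{k≥0} generated by approximate policy iteration: for each k there is a function V̂_k : S → ℝ such that π_{k+1} is greedy with respect to V̂_k. Then limsup_{k→∞} ‖V* − V^{π_k}‖_∞ ≤ (2·γ / (1 − γ)²) · limsup_{k→∞} ‖V̂_k − V^{π_k}‖_∞. -/
open Filter

theorem api_Q_mono {S A : Type*} [Fintype S] (ρ : S → A → S → ℝ)
    [Fintype A] (hρ : ∀ s a, IsPMF (ρ s a)) (r : S → A → ℝ) (γ : ℝ) (hγ0 : 0 < γ)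
    (U V : S → ℝ) (c : ℝ) (h : ∀ s, U s ≤ V s + c) (s : S) (a : A) :
    r s a + γ * ∑ s', ρ s a s' * U s' ≤ r s a + γ * ∑ s', ρ s a s' * V s' + γ * c := by
  have h1 : ∑ s', ρ s a s' * U s' ≤ ∑ s', ρ s a s' * (V s' + c) :=
    Finset.sum_le_sum fun x _ => mul_le_mul_of_nonneg_left (h x) ((hρ s a).1 x)
  have h2 : ∑ s', ρ s a s' * (V s' + c) = ∑ s', ρ s a s' * V s' + c := by
    simp only [mul_add, Finset.sum_add_distrib, ← Finset.sum_mul, (hρ s a).2, one_mul]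
  rw [h2] at h1
  have := mul_le_mul_of_nonneg_left h1 hγ0.le
  linarith

theorem api_avg_mono {A : Type*} [Fintype A] (p : A → ℝ) (hp : IsPMF p)
    (f g : A → ℝ) (c : ℝ) (h : ∀ a, p a ≠ 0 → f a ≤ g a + c) :
    ∑ a, p a * f a ≤ ∑ a, p a * g a + c := by
  have h1 : ∑ a, p a * f a ≤ ∑ a, p a * (g a + c) := by
    refine Finset.sum_le_sum fun x _ => ?_
    by_cases hx : p x = 0
    · simp [hx]
    · exact mul_le_mul_of_nonneg_left (h x hx) (hp.1 x)
  have h2 : ∑ a, p a * (g a + c) = ∑ a, p a * g a + c := by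
    simp only [mul_add, Finset.sum_add_distrib, ← Finset.sum_mul, hp.2, one_mul]
  linarith

theorem api_contr {S : Type*} [Fintype S] [Nonempty S] (γ : ℝ) (hγ1 : γ < 1)
    (f : S → ℝ) (c : ℝ) (h : ∀ m, (∀ s, f s ≤ m) → ∀ s, f s ≤ γ * m + c) (s : S) :
    f s ≤ c / (1 - γ) := by
  obtain ⟨t, ht⟩ := Finite.exists_max f
  refine (ht s).trans ?_
  rw [le_div_iff₀ (by linarith)]
  have := h _ ht t
  linarith

theorem api_step
    {S A : Type*} [Fintype S] [Nonempty S] [Fintype A] [Nonempty A]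
    (ρ : S → A → S → ℝ) (hρ : ∀ s a, IsPMF (ρ s a))
    (r : S → A → ℝ) (γ : ℝ) (hγ0 : 0 < γ) (hγ1 : γ < 1)
    (Vstar : S → ℝ) (hVstar : IsOptValue ρ r γ Vstar)
    (p p' : S → A → ℝ) (hp : ∀ s, IsPMF (p s)) (hp' : ∀ s, IsPMF (p' s))
    (V V' W : S → ℝ) (hV : IsValue ρ r γ p V) (hV' : IsValue ρ r γ p' V')
    (hg : IsGreedy ρ r γ W p') (e d : ℝ) (he : ∀ s, |W s - V s| ≤ e)
    (hd : ∀ s, |Vstar s - V s| ≤ d) (s : S) :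
    |Vstar s - V' s| ≤ γ * d + 2 * γ / (1 - γ) * e := by
  have hγ : 0 < 1 - γ := by linarith
  have hbell : ∀ s a, r s a + γ * ∑ s', ρ s a s' * Vstar s' ≤ Vstar s := by
    intro s a
    rw [hVstar s]
    exact Finset.le_sup' (fun a => r s a + γ * ∑ s', ρ s a s' * Vstar s') (Finset.mem_univ a)
  have hopt : ∀ s, V' s - Vstar s ≤ 0 := by
    intro s
    have := api_contr γ hγ1 (fun s => V' s - Vstar s) 0 ?_ s
    · simpa using this
    intro m hm s
    have h1 := api_avg_mono (p' s) (hp' s)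
      (fun a => r s a + γ * ∑ s', ρ s a s' * V' s') (fun _ => Vstar s) (γ * m) (fun a _ => by
        have := api_Q_mono ρ hρ r γ hγ0 V' Vstar m (fun s => by linarith [hm s]) s a
        linarith [hbell s a])
    rw [← hV' s, ← Finset.sum_mul, (hp' s).2] at h1
    linarith
  -- greedy actions are nearly greedy for V
  have hgr : ∀ s a, p' s a ≠ 0 → ∀ b, r s b + γ * ∑ s', ρ s b s' * V s' ≤
      r s a + γ * ∑ s', ρ s a s' * V s' + 2 * γ * e := by
    intro s a ha b
    have h1 := api_Q_mono ρ hρ r γ hγ0 V W e (fun s => by linarith [(abs_le.1 (he s)).1]) s b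
    have h2 := api_Q_mono ρ hρ r γ hγ0 W V e (fun s => by linarith [(abs_le.1 (he s)).2]) s a
    linarith [hg s a ha b]
  have himp : ∀ s, V s - V' s ≤ 2 * γ * e / (1 - γ) := by
    refine api_contr γ hγ1 _ _ ?_
    intro m hm s
    have h1 := api_avg_mono (p' s) (hp' s) (fun _ => V s)
      (fun a => r s a + γ * ∑ s', ρ s a s' * V' s') (γ * m + 2 * γ * e) (fun a ha => by
        have h2 := api_Q_mono ρ hρ r γ hγ0 V V' m (fun s => by linarith [hm s]) s a
        have h3 := api_avg_mono (p s) (hp s)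
          (fun a => r s a + γ * ∑ s', ρ s a s' * V s')
          (fun _ => r s a + γ * ∑ s', ρ s a s' * V s') (2 * γ * e) (fun b _ => hgr s a ha b)
        rw [← hV s, ← Finset.sum_mul, (hp s).2] at h3
        linarith)
    rw [← hV' s, ← Finset.sum_mul, (hp' s).2] at h1
    linarith
  have hmain : Vstar s - V' s ≤ γ * d + (2 * γ * e + γ * (2 * γ * e / (1 - γ))) := by
    have h1 := api_avg_mono (p' s) (hp' s) (fun _ => Vstar s)
      (fun a => r s a + γ * ∑ s', ρ s a s' * V' s')
      (γ * d + (2 * γ * e + γ * (2 * γ * e / (1 - γ)))) (fun a ha => by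
        have h2 := api_Q_mono ρ hρ r γ hγ0 V V' (2 * γ * e / (1 - γ)) (fun s => by linarith [himp s]) s a
        have h3 : Vstar s ≤ r s a + γ * ∑ s', ρ s a s' * V s' + 2 * γ * e + γ * d := by
          rw [hVstar s]
          refine Finset.sup'_le _ _ fun b _ => ?_
          have h4 := api_Q_mono ρ hρ r γ hγ0 Vstar V d
            (fun s => by linarith [(abs_le.1 (hd s)).2]) s b
          linarith [hgr s a ha b]
        linarith)
    rw [← hV' s, ← Finset.sum_mul, (hp' s).2] at h1
    linarith
  have heq : 2 * γ * e + γ * (2 * γ * e / (1 - γ)) = 2 * γ / (1 - γ) * e := by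
    field_simp
    ring
  rw [abs_of_nonneg (by linarith [hopt s])]
  linarith

theorem api_limsup (γ C : ℝ) (hγ0 : 0 < γ) (hγ1 : γ < 1) (hC : 0 < C) (d e : ℕ → ℝ)
    (he : ∀ k, 0 ≤ e k) (h : ∀ k, d (k + 1) ≤ γ * d k + C * e k) :
    Filter.limsup (fun k => (d k : EReal)) atTop ≤
      ((C / (1 - γ) : ℝ) : EReal) * Filter.limsup (fun k => (e k : EReal)) atTop := by
  have hγ : 0 < 1 - γ := by linarith
  have hK : 0 < C / (1 - γ) := div_pos hC hγ
  have key : ∀ c : ℝ, Filter.limsup (fun k => (e k : EReal)) atTop < c →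
      Filter.limsup (fun k => (d k : EReal)) atTop ≤ ((C / (1 - γ) * c : ℝ) : EReal) := by
    intro c hc
    obtain ⟨N, hN⟩ := eventually_atTop.1 (eventually_lt_of_limsup_lt hc)
    have hb : ∀ n, d (n + N) ≤ γ ^ n * (d N - C / (1 - γ) * c) + C / (1 - γ) * c := by
      intro n
      induction n with
      | zero => simp
      | succ n ih =>
        have h1 := h (n + N)
        have h2 : e (n + N) ≤ c := by
          have := hN (n + N) (by omega)
          exact (EReal.coe_lt_coe_iff.1 this).le
        have h3 := mul_le_mul_of_nonneg_left h2 hC.le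
        have h4 := mul_le_mul_of_nonneg_left ih hγ0.le
        have h5 : C * c = (1 - γ) * (C / (1 - γ) * c) := by field_simp
        rw [show n + 1 + N = n + N + 1 by ring, pow_succ]
        nlinarith
    have ht : Tendsto (fun n : ℕ => γ ^ n * (d N - C / (1 - γ) * c) + C / (1 - γ) * c) atTop
        (nhds (C / (1 - γ) * c)) := by
      simpa using ((tendsto_pow_atTop_nhds_zero_of_lt_one hγ0.le hγ1).mul_const
        (d N - C / (1 - γ) * c)).add_const (C / (1 - γ) * c)
    have ht' := (continuous_coe_real_ereal.tendsto _).comp ht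
    rw [← Filter.limsup_nat_add _ N, ← ht'.limsup_eq]
    exact Filter.limsup_le_limsup (Eventually.of_forall fun n => EReal.coe_le_coe_iff.2 (hb n))
  have h0 : (0 : EReal) ≤ Filter.limsup (fun k => (e k : EReal)) atTop := by
    refine le_limsup_of_frequently_le (Frequently.of_forall fun k => ?_)
    exact_mod_cast he k
  generalize Filter.limsup (fun k => (e k : EReal)) atTop = E at *
  induction E with
  | bot => simp at h0
  | top => rw [EReal.coe_mul_top_of_pos hK]; exact le_top
  | coe x =>
    have ht : Tendsto (fun n : ℕ => C / (1 - γ) * (x + 1 / ((n : ℝ) + 1))) atTop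
        (nhds (C / (1 - γ) * x)) := by
      simpa using ((tendsto_one_div_add_atTop_nhds_zero_nat (𝕜 := ℝ)).const_add x).const_mul
        (C / (1 - γ))
    have ht' := (continuous_coe_real_ereal.tendsto _).comp ht
    rw [← EReal.coe_mul]
    refine ge_of_tendsto' ht' fun n => key _ ?_
    have : (0 : ℝ) < 1 / ((n : ℝ) + 1) := by positivity
    exact EReal.coe_lt_coe_iff.2 (by linarith)

/-- **Approximate policy iteration error bound (Bertsekas–Tsitsiklis).** If each `π_{k+1}` is
greedy with respect to `V̂_k`, then
`limsup_k ‖V* − V^{π_k}‖_∞ ≤ (2γ/(1 − γ)²) · limsup_k ‖V̂_k − V^{π_k}‖_∞`. -/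
theorem api_error_propagation
    {S A : Type*} [Fintype S] [Nonempty S] [Fintype A] [Nonempty A]
    (ρ : S → A → S → ℝ) (hρ : ∀ s a, IsPMF (ρ s a))
    (r : S → A → ℝ) (γ : ℝ) (hγ0 : 0 < γ) (hγ1 : γ < 1)
    (Vstar : S → ℝ) (hVstar : IsOptValue ρ r γ Vstar)
    (π : ℕ → S → A → ℝ) (hπpmf : ∀ k s, IsPMF (π k s))
    (Vπ : ℕ → S → ℝ) (hVπ : ∀ k, IsValue ρ r γ (π k) (Vπ k))
    (Vhat : ℕ → S → ℝ) (hgreedy : ∀ k, IsGreedy ρ r γ (Vhat k) (π (k + 1))) :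
    Filter.limsup (fun k => ((supNorm (fun s => Vstar s - Vπ k s) : ℝ) : EReal)) atTop ≤
      ((2 * γ / (1 - γ) ^ 2 : ℝ) : EReal) *
        Filter.limsup (fun k => ((supNorm (fun s => Vhat k s - Vπ k s) : ℝ) : EReal)) atTop := by
  have hγ : 0 < 1 - γ := by linarith
  have hle : ∀ (f : S → ℝ) (s : S), |f s| ≤ supNorm f := fun f s =>
    Finset.le_sup' (fun s => |f s|) (Finset.mem_univ s)
  have hKeq : 2 * γ / (1 - γ) ^ 2 = 2 * γ / (1 - γ) / (1 - γ) := by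
    rw [div_div, sq]
  rw [hKeq]
  refine api_limsup γ (2 * γ / (1 - γ)) hγ0 hγ1 (by positivity)
    (fun k => supNorm (fun s => Vstar s - Vπ k s))
    (fun k => supNorm (fun s => Vhat k s - Vπ k s)) (fun k => ?_) (fun k => ?_)
  · exact (abs_nonneg _).trans (hle (fun s => Vhat k s - Vπ k s) (Classical.arbitrary S))
  · refine Finset.sup'_le _ _ fun s _ => ?_
    exact api_step ρ hρ r γ hγ0 hγ1 Vstar hVstar (π k) (π (k + 1)) (hπpmf k) (hπpmf (k + 1))
      (Vπ k) (Vπ (k + 1)) (Vhat k) (hVπ k) (hVπ (k + 1)) (hgreedy k) _ _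
      (hle (fun s => Vhat k s - Vπ k s)) (hle (fun s => Vstar s - Vπ k s)) s
end

section
/- Consider a finite MDP, a policy π, a function V̂ : S → ℝ with ‖V̂ − V^π‖_∞ ≤ ε for some ε ≥ 0, and a policy π' that is greedy with respect to V̂. Then for every state s, V^π(s) − V^{π'}(s) ≤ 2·γ·ε / (1 − γ); that is, the approximate policy improvement step can degrade the value by at most 2γε/(1−γ) at every state. -/
/-- **Approximate policy improvement degradation bound (Bertsekas–Tsitsiklis, Lemma 6.1).**
If `‖V̂ − V^π‖_∞ ≤ ε` and `π'` is greedy with respect to `V̂`, then for every state `s`,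
`V^π(s) − V^{π'}(s) ≤ 2γε/(1 − γ)`. -/
theorem approx_policy_improvement_degradation
    {S A : Type*} [Fintype S] [Nonempty S] [Fintype A] [Nonempty A]
    (ρ : S → A → S → ℝ) (hρ : ∀ s a, IsPMF (ρ s a))
    (r : S → A → ℝ) (γ : ℝ) (hγ0 : 0 < γ) (hγ1 : γ < 1)
    (π : S → A → ℝ) (hπpmf : ∀ s, IsPMF (π s))
    (Vπ : S → ℝ) (hVπ : IsValue ρ r γ π Vπ)
    (Vhat : S → ℝ) (ε : ℝ) (hε : 0 ≤ ε) (hbound : ∀ s, |Vhat s - Vπ s| ≤ ε)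
    (π' : S → A → ℝ) (hπ'pmf : ∀ s, IsPMF (π' s)) (hgreedy : IsGreedy ρ r γ Vhat π')
    (Vπ' : S → ℝ) (hVπ' : IsValue ρ r γ π' Vπ') :
    ∀ s, Vπ s - Vπ' s ≤ 2 * γ * ε / (1 - γ) := by
  obtain ⟨s₀, hs₀⟩ := Finite.exists_max (fun s => Vπ s - Vπ' s)
  have key : ∀ (U W : S → ℝ) (c : ℝ), (∀ s, U s ≤ W s + c) → ∀ s a,
      r s a + γ * ∑ s', ρ s a s' * U s' ≤ (r s a + γ * ∑ s', ρ s a s' * W s') + γ * c := by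
    intro U W c h s a
    have h1 : ∑ s', ρ s a s' * U s' ≤ ∑ s', ρ s a s' * (W s' + c) :=
      Finset.sum_le_sum fun s' _ => mul_le_mul_of_nonneg_left (h s') ((hρ s a).1 s')
    have h2 : ∑ s', ρ s a s' * (W s' + c) = ∑ s', ρ s a s' * W s' + c := by
      simp only [mul_add, Finset.sum_add_distrib, ← Finset.sum_mul, (hρ s a).2, one_mul]
    rw [h2] at h1
    have h3 := mul_le_mul_of_nonneg_left h1 hγ0.le
    linarith
  obtain ⟨b, hb⟩ := Finite.exists_max (fun a => r s₀ a + γ * ∑ s', ρ s₀ a s' * Vhat s')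
  set m := r s₀ b + γ * ∑ s', ρ s₀ b s' * Vhat s' with hm
  have up : Vπ s₀ ≤ m + γ * ε := by
    rw [hVπ s₀]
    calc _ ≤ ∑ a, π s₀ a * (m + γ * ε) := by
          refine Finset.sum_le_sum fun a _ => mul_le_mul_of_nonneg_left ?_ ((hπpmf s₀).1 a)
          have h1 := key Vπ Vhat ε (fun s => by linarith [(abs_le.1 (hbound s)).1]) s₀ a
          have h2 := hb a
          linarith
      _ = _ := by rw [← Finset.sum_mul, (hπpmf s₀).2, one_mul]
  have lo : m - γ * (ε + (Vπ s₀ - Vπ' s₀)) ≤ Vπ' s₀ := by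
    have h0 := hVπ' s₀
    have h : ∑ a, π' s₀ a * (m - γ * (ε + (Vπ s₀ - Vπ' s₀))) ≤
        ∑ a, π' s₀ a * (r s₀ a + γ * ∑ s', ρ s₀ a s' * Vπ' s') := by
      refine Finset.sum_le_sum fun a _ => ?_
      by_cases ha : π' s₀ a = 0
      · simp [ha]
      refine mul_le_mul_of_nonneg_left ?_ ((hπ'pmf s₀).1 a)
      have h1 := key Vhat Vπ' (ε + (Vπ s₀ - Vπ' s₀))
        (fun s => by
          have := hs₀ s
          linarith [(abs_le.1 (hbound s)).2]) s₀ a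
      have h2 := hgreedy s₀ a ha b
      linarith
    rw [← Finset.sum_mul, (hπ'pmf s₀).2, one_mul, ← h0] at h
    exact h
  intro s
  rw [le_div_iff₀ (by linarith)]
  have h1 : Vπ s - Vπ' s ≤ Vπ s₀ - Vπ' s₀ := hs₀ s
  have h2 := mul_le_mul_of_nonneg_right h1 (sub_nonneg.2 hγ1.le)
  nlinarith
end

section
/- Consider a finite MDP and a sequence of policies (π_k)_{k≥0} generated by approximate policy iteration: for each k there is a function V̂_k : S → ℝ such that π_{k+1} is greedy with respect to V̂_k, and suppose there is ε ≥ 0 with ‖V̂_k − V^{π_k}‖_∞ ≤ ε for every k. Then limsup_{k→∞} ‖V* − V^{π_{k+1}}‖_∞ ≤ 2·γ·(1 + γ²)·ε / (1 − γ)³. -/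
open Filter

lemma IsPMF.le_avg {X : Type*} [Fintype X] {p : X → ℝ} (hp : IsPMF p) (f : X → ℝ) (m : ℝ)
    (h : ∀ x, p x ≠ 0 → m ≤ f x) : m ≤ ∑ x, p x * f x := by
  have h1 : m = ∑ x, p x * m := by rw [← Finset.sum_mul, hp.2, one_mul]
  rw [h1]
  apply Finset.sum_le_sum
  intro x _
  by_cases hx : p x = 0
  · simp [hx]
  · exact mul_le_mul_of_nonneg_left (h x hx) (hp.1 x)

lemma IsPMF.avg_le {X : Type*} [Fintype X] {p : X → ℝ} (hp : IsPMF p) (f : X → ℝ) (m : ℝ)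
    (h : ∀ x, f x ≤ m) : ∑ x, p x * f x ≤ m := by
  have h1 : m = ∑ x, p x * m := by rw [← Finset.sum_mul, hp.2, one_mul]
  rw [h1]
  exact Finset.sum_le_sum fun x _ => mul_le_mul_of_nonneg_left (h x) (hp.1 x)

lemma q_shift {S : Type*} [Fintype S] {p : S → ℝ} (hp : IsPMF p) (c γ : ℝ) (hγ : 0 < γ)
    (V W : S → ℝ) (d : ℝ) (h : ∀ s, V s ≤ W s + d) :
    c + γ * ∑ s, p s * V s ≤ c + γ * ∑ s, p s * W s + γ * d := by
  have h1 := hp.avg_le (fun s => V s - W s) d (fun s => by linarith [h s])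
  simp only [mul_sub, Finset.sum_sub_distrib] at h1
  nlinarith

lemma min_bound {S : Type*} [Fintype S] [Nonempty S] (f : S → ℝ) (γ c : ℝ) (hγ : γ < 1)
    (h : ∀ m, (∀ s, m ≤ f s) → ∀ s, γ * m - c ≤ f s) : ∀ s, -(c / (1 - γ)) ≤ f s := by
  obtain ⟨s0, hs0⟩ := Finite.exists_min f
  have h1 := h (f s0) hs0 s0
  have h2 : -(c / (1 - γ)) ≤ f s0 := by
    rw [← neg_div, div_le_iff₀ (by linarith)]
    nlinarith
  exact fun s => h2.trans (hs0 s)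

/-- **Greedy-policy suboptimality under approximate policy iteration.** If each `π_{k+1}` is
greedy with respect to `V̂_k` and `‖V̂_k − V^{π_k}‖_∞ ≤ ε` for every `k`, then
`limsup_k ‖V* − V^{π_{k+1}}‖_∞ ≤ 2γ(1 + γ²)ε/(1 − γ)³`. -/
theorem api_greedy_suboptimality
    {S A : Type*} [Fintype S] [Nonempty S] [Fintype A] [Nonempty A]
    (ρ : S → A → S → ℝ) (hρ : ∀ s a, IsPMF (ρ s a))
    (r : S → A → ℝ) (γ : ℝ) (hγ0 : 0 < γ) (hγ1 : γ < 1)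
    (Vstar : S → ℝ) (hVstar : IsOptValue ρ r γ Vstar)
    (π : ℕ → S → A → ℝ) (hπpmf : ∀ k s, IsPMF (π k s))
    (Vπ : ℕ → S → ℝ) (hVπ : ∀ k, IsValue ρ r γ (π k) (Vπ k))
    (Vhat : ℕ → S → ℝ) (hgreedy : ∀ k, IsGreedy ρ r γ (Vhat k) (π (k + 1)))
    (ε : ℝ) (hε : 0 ≤ ε) (hbound : ∀ k, supNorm (fun s => Vhat k s - Vπ k s) ≤ ε) :
    Filter.limsup (fun k => supNorm (fun s => Vstar s - Vπ (k + 1) s)) atTop ≤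
      2 * γ * (1 + γ ^ 2) * ε / (1 - γ) ^ 3 := by
  have h1γ : 0 < 1 - γ := by linarith
  have hb : ∀ k s, |Vhat k s - Vπ k s| ≤ ε := fun k s =>
    (Finset.le_sup' (fun s => |Vhat k s - Vπ k s|) (Finset.mem_univ s)).trans (hbound k)
  -- one-step comparison
  have key : ∀ k m, (∀ s, m ≤ Vπ (k + 1) s - Vπ k s) → ∀ s a',
      r s a' + γ * ∑ s', ρ s a' s' * Vπ k s' - 2 * γ * ε + γ * m ≤ Vπ (k + 1) s := by
    intro k m hm s a'
    rw [hVπ (k + 1) s]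
    apply (hπpmf (k + 1) s).le_avg
    intro a ha
    have g := hgreedy k s a ha a'
    have e1 := q_shift (hρ s a') (r s a') γ hγ0 (Vπ k) (Vhat k) ε
      (fun t => by linarith [(abs_le.1 (hb k t)).1])
    have e2 := q_shift (hρ s a) (r s a) γ hγ0 (Vhat k) (Vπ k) ε
      (fun t => by linarith [(abs_le.1 (hb k t)).2])
    have e3 := q_shift (hρ s a) (r s a) γ hγ0 (Vπ k) (Vπ (k + 1)) (-m)
      (fun t => by linarith [hm t])
    linarith
  have impr : ∀ k s, -(2 * γ * ε / (1 - γ)) ≤ Vπ (k + 1) s - Vπ k s := by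
    intro k
    apply min_bound _ γ _ hγ1
    intro m hm s
    have h2 : Vπ k s ≤ Vπ (k + 1) s + 2 * γ * ε - γ * m := by
      conv_lhs => rw [hVπ k s]
      apply (hπpmf k s).avg_le
      intro a
      linarith [key k m hm s a]
    linarith
  have hopt : ∀ s a, r s a + γ * ∑ s', ρ s a s' * Vstar s' ≤ Vstar s := by
    intro s a
    conv_rhs => rw [hVstar s]
    exact Finset.le_sup' (fun a => r s a + γ * ∑ s', ρ s a s' * Vstar s') (Finset.mem_univ a)
  have hnn : ∀ k s, 0 ≤ Vstar s - Vπ k s := by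
    intro k
    have := min_bound (fun s => Vstar s - Vπ k s) γ 0 hγ1 (by
      intro m hm s
      have h2 : Vπ k s ≤ Vstar s - γ * m := by
        conv_lhs => rw [hVπ k s]
        apply (hπpmf k s).avg_le
        intro a
        have e := q_shift (hρ s a) (r s a) γ hγ0 (Vπ k) Vstar (-m)
          (fun t => by linarith [hm t])
        linarith [hopt s a]
      linarith)
    simpa using this
  have step : ∀ k D, (∀ s, Vstar s - Vπ k s ≤ D) →
      ∀ s, Vstar s - Vπ (k + 1) s ≤ γ * D + 2 * γ * ε / (1 - γ) := by
    intro k D hD s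
    have h2 : Vstar s ≤ Vπ (k + 1) s + 2 * γ * ε + γ * (2 * γ * ε / (1 - γ)) + γ * D := by
      rw [hVstar s]
      apply Finset.sup'_le
      intro a _
      have e := q_shift (hρ s a) (r s a) γ hγ0 Vstar (Vπ k) D (fun t => by linarith [hD t])
      linarith [key k _ (impr k) s a]
    have h3 : 2 * γ * ε + γ * (2 * γ * ε / (1 - γ)) = 2 * γ * ε / (1 - γ) := by
      field_simp
      ring
    linarith
  obtain ⟨s0, hs0⟩ := Finite.exists_max (fun s => Vstar s - Vπ 0 s)
  set D0 := Vstar s0 - Vπ 0 s0 with hD0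
  have hD0n : 0 ≤ D0 := hnn 0 s0
  set c := 2 * γ * ε / (1 - γ) ^ 2 with hc
  have hcn : 0 ≤ c := by positivity
  have hcc : γ * c + 2 * γ * ε / (1 - γ) = c := by
    rw [hc]
    field_simp
    ring
  have all : ∀ k s, Vstar s - Vπ k s ≤ γ ^ k * D0 + c := by
    intro k
    induction k with
    | zero => intro s; have := hs0 s; simp only [pow_zero, one_mul]; linarith
    | succ k ih =>
      intro s
      have := step k _ ih s
      rw [pow_succ]
      linarith
  have hlim : Tendsto (fun k : ℕ => γ ^ (k + 1) * D0 + c) atTop (nhds c) := by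
    have h := (tendsto_pow_atTop_nhds_zero_of_lt_one hγ0.le hγ1).comp (tendsto_add_atTop_nat 1)
    simpa using (h.mul_const D0).add_const c
  have hle : ∀ k, supNorm (fun s => Vstar s - Vπ (k + 1) s) ≤ γ ^ (k + 1) * D0 + c := by
    intro k
    apply Finset.sup'_le
    intro s _
    rw [abs_of_nonneg (hnn _ s)]
    exact all _ s
  have hge : ∀ k, 0 ≤ supNorm (fun s => Vstar s - Vπ (k + 1) s) := fun k =>
    (abs_nonneg _).trans
      (Finset.le_sup' (fun s => |Vstar s - Vπ (k + 1) s|) (Finset.mem_univ s0))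
  have hfin : c ≤ 2 * γ * (1 + γ ^ 2) * ε / (1 - γ) ^ 3 := by
    rw [hc, div_le_div_iff₀ (by positivity) (by positivity)]
    have h4 : 0 ≤ 2 * γ * ε * (1 - γ) ^ 2 * (γ + γ ^ 2) := by positivity
    nlinarith
  refine le_trans ?_ hfin
  rw [← hlim.limsup_eq]
  refine limsup_le_limsup (Eventually.of_forall hle) ?_ hlim.isBoundedUnder_le
  exact (isBoundedUnder_of ⟨0, hge⟩ : IsBoundedUnder (· ≥ ·) atTop _).isCoboundedUnder_le
end
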